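/- arXiv:1301.4102 — 2 statements merged into one kernel-verified Lean document; each statement's English description precedes it below -/
import Mathlib

section
/- For any nonzero complex number z, the pair (z, e^z) does not belong to (Q̄)², where Q̄ denotes the algebraic closure of Q in C. In other words, if z ≠ 0 is algebraic over Q, then e^z is transcendental over Q. -/
open Polynomial in
theorem Polynomial.isIntegral_pow_mul_aeval {A : Type*} [CommRing A] {a : ℤ} {x : A}
    (hx : IsIntegral ℤ (a * x)) (g : ℤ[X]) {N : ℕ} (hN : g.natDegree ≤ N) :
    IsIntegral ℤ (a ^ N * aeval x g) := by
  rw [aeval_eq_sum_range' (Nat.lt_succ_of_le hN), Finset.mul_sum]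
  refine IsIntegral.sum _ fun i hi ↦ ?_
  have hi : i ≤ N := Nat.lt_succ_iff.mp (Finset.mem_range.mp hi)
  have : (a : A) ^ N * g.coeff i • x ^ i = (a ^ (N - i) * g.coeff i : ℤ) * (a * x) ^ i := by
    rw [← Nat.sub_add_cancel hi, pow_add, Nat.add_sub_cancel, zsmul_eq_mul]
    push_cast
    ring
  rw [this]
  exact (isIntegral_algebraMap (R := ℤ) (A := A) (x := a ^ (N - i) * g.coeff i)).mul (hx.pow i)

open Polynomial in
theorem exists_int_polynomial_aeval_eq_zero {A : Type*} [CommRing A] [IsDomain A]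
    (S : Finset A) (h₀ : 0 ∉ S) (hS : ∀ v ∈ S, IsAlgebraic ℤ v) :
    ∃ f : ℤ[X], f.eval 0 ≠ 0 ∧ ∀ v ∈ S, aeval v f = 0 := by
  have (v : A) : ∃ f : ℤ[X], f.eval 0 ≠ 0 ∧ (v ∈ S → aeval v f = 0) := by
    by_cases hv : v ∈ S
    · obtain ⟨q, hq, hq'⟩ := (hS v hv).exists_nonzero_coeff_and_aeval_eq_zero
        (mem_nonZeroDivisors_of_ne_zero (ne_of_mem_of_not_mem hv h₀))
      exact ⟨q, by rwa [← coeff_zero_eq_eval_zero], fun _ ↦ hq'⟩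
    · exact ⟨1, by simp, fun h ↦ absurd h hv⟩
  choose f hf hf' using this
  refine ⟨∏ v ∈ S, f v, ?_, fun v hv ↦ ?_⟩
  · rw [eval_prod]
    exact Finset.prod_ne_zero_iff.mpr fun v _ ↦ hf v
  · rw [map_prod]
    exact Finset.prod_eq_zero hv (hf' v hv)

theorem IsIntegral.exists_int_of_fixed {L : Type*} [Field L] [NumberField L] [IsGalois ℚ L]
    {x : L} (hx : IsIntegral ℤ x) (h : ∀ σ : L ≃ₐ[ℚ] L, σ x = x) : ∃ m : ℤ, (m : L) = x := by
  obtain ⟨q, rfl⟩ := (IsGalois.mem_range_algebraMap_iff_fixed x).mpr h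
  have hq : IsIntegral ℤ q :=
    (isIntegral_algebraMap_iff (algebraMap ℚ L).injective).mp hx
  obtain ⟨m, rfl⟩ := IsIntegrallyClosed.isIntegral_iff.mp hq
  exact ⟨m, by simp⟩

theorem tendsto_pow_div_factorial_pred (C : ℝ) :
    Filter.Tendsto (fun p : ℕ ↦ C ^ p / ((p - 1).factorial : ℝ)) Filter.atTop (nhds 0) := by
  rw [← Filter.tendsto_add_atTop_iff_nat 1]
  have := (FloorSemiring.tendsto_pow_div_factorial_atTop C).const_mul C
  rw [mul_zero] at this
  refine this.congr fun p ↦ ?_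
  rw [Nat.add_sub_cancel, pow_succ']
  ring

open Polynomial in
/-- If an integral combination of exponentials of elements of a Galois number field has Galois
invariant coefficients, and the coefficient of `exp 0` is nonzero, then it does not vanish. -/
theorem sum_mul_exp_ne_zero_of_invariant {L : Type*} [Field L] [NumberField L] [IsGalois ℚ L]
    [Algebra L ℂ] (c : L →₀ ℤ) (hc₀ : c 0 ≠ 0) (hc : ∀ (σ : L ≃ₐ[ℚ] L) v, c (σ v) = c v) :
    c.sum (fun v m ↦ (m : ℂ) * Complex.exp (algebraMap L ℂ v)) ≠ 0 := by
  classical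
  intro hsum
  set S := c.support.erase 0 with hS
  have hexp : ∑ v ∈ S, (c v : ℂ) * Complex.exp (algebraMap L ℂ v) = -c 0 := by
    rw [Finsupp.sum, ← Finset.add_sum_erase _ _ (Finsupp.mem_support_iff.mpr hc₀)] at hsum
    rw [eq_neg_iff_add_eq_zero, add_comm]
    simpa using hsum
  obtain ⟨f, hf₀, hf⟩ := exists_int_polynomial_aeval_eq_zero S (Finset.notMem_erase 0 _)
    fun v _ ↦ (IsFractionRing.isAlgebraic_iff ℤ ℚ L).mpr (Algebra.IsAlgebraic.isAlgebraic v)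
  have hf_ne : f ≠ 0 := by rintro rfl; simp at hf₀
  set a := f.leadingCoeff
  have ha : a ≠ 0 := leadingCoeff_ne_zero.mpr hf_ne
  have hS_int {v : L} (hv : v ∈ S) : IsIntegral ℤ ((a : L) * v) := by
    simpa using isIntegral_leadingCoeff_smul f v (hf v hv)
  obtain ⟨C, hC⟩ := LindemannWeierstrass.exp_polynomial_approx f hf₀
  set K : ℝ := ∑ v ∈ S, |(c v : ℝ)|
  have hlim := (tendsto_pow_div_factorial_pred (|(a : ℝ)| ^ f.natDegree * C)).const_mul K
  rw [mul_zero] at hlim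
  obtain ⟨B, hB⟩ := Filter.eventually_atTop.mp (hlim.eventually (gt_mem_nhds one_pos))
  obtain ⟨p, hpge, hp⟩ := Nat.exists_infinite_primes
    (B + (f.eval 0).natAbs + 1 + (a * c 0).natAbs + 1)
  obtain ⟨n, hpn, g, hg, happ⟩ := hC p (by omega) hp
  set N := p * f.natDegree
  obtain ⟨M, hM⟩ : ∃ M : ℤ, (M : L) = (a : L) ^ N * ∑ v ∈ S, (c v : L) * aeval v g := by
    apply IsIntegral.exists_int_of_fixed
    · rw [Finset.mul_sum]
      refine IsIntegral.sum _ fun v hv ↦ ?_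
      rw [mul_left_comm]
      exact (isIntegral_algebraMap (R := ℤ) (A := L) (x := c v)).mul
        (isIntegral_pow_mul_aeval (hS_int hv) g (hg.trans (Nat.sub_le _ _)))
    · intro σ
      rw [map_mul, map_pow, map_intCast, map_sum]
      congr 1
      refine Finset.sum_equiv σ.toEquiv (fun v ↦ ?_) fun v _ ↦ ?_
      · simp [hS, hc]
      · simp only [map_mul, map_intCast]
        congr 1
        · simp [hc]
        · exact (aeval_algHom_apply (σ.toAlgHom.restrictScalars ℤ) v g).symm
  set Q : ℤ := a ^ N * c 0 * n + p * M
  have hQ : Q ≠ 0 := by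
    intro h
    have hdvd : (p : ℤ) ∣ a ^ N * c 0 * n := by
      rw [eq_neg_of_add_eq_zero_left h]
      exact (dvd_mul_right _ _).neg_right
    have hp' := Nat.prime_iff_prime_int.mp hp
    have hac : (p : ℤ) ∣ a * c 0 := by
      rcases hp'.dvd_or_dvd ((hp'.dvd_or_dvd hdvd).resolve_right hpn) with h | h
      · exact (hp'.dvd_of_dvd_pow h).mul_right _
      · exact h.mul_left _
    have := Nat.le_of_dvd (Int.natAbs_pos.mpr (mul_ne_zero ha hc₀)) (Int.natCast_dvd.mp hac)
    omega
  have hQ_eq : (Q : ℂ) = -((a : ℂ) ^ N * ∑ v ∈ S, (c v : ℂ) *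
      (n • Complex.exp (algebraMap L ℂ v) - p • aeval (algebraMap L ℂ v) g)) := by
    have hM' := congrArg (algebraMap L ℂ) hM
    simp only [map_mul, map_pow, map_intCast, map_sum, ← aeval_algebraMap_apply] at hM'
    have : ∑ v ∈ S, (c v : ℂ) *
        (n • Complex.exp (algebraMap L ℂ v) - p • aeval (algebraMap L ℂ v) g) =
        n * ∑ v ∈ S, (c v : ℂ) * Complex.exp (algebraMap L ℂ v) -
        p * ∑ v ∈ S, (c v : ℂ) * aeval (algebraMap L ℂ v) g := by
      simp only [Finset.mul_sum, ← Finset.sum_sub_distrib, zsmul_eq_mul, nsmul_eq_mul]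
      exact Finset.sum_congr rfl fun _ _ ↦ by ring
    rw [this, hexp]
    simp only [Q]
    push_cast
    rw [hM']
    ring
  have hlt := hB p (by omega)
  have hle : (1 : ℝ) ≤ ‖(Q : ℂ)‖ := by
    rw [Complex.norm_intCast]
    exact_mod_cast Int.one_le_abs hQ
  have hupper : ‖(Q : ℂ)‖ ≤
      K * ((|(a : ℝ)| ^ f.natDegree * C) ^ p / ((p - 1).factorial : ℝ)) := by
    rw [hQ_eq, norm_neg, norm_mul, norm_pow, Complex.norm_intCast]
    calc _ ≤ |(a : ℝ)| ^ N * ∑ v ∈ S, |(c v : ℝ)| * (C ^ p / ((p - 1).factorial : ℝ)) := by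
          gcongr
          refine (norm_sum_le _ _).trans (Finset.sum_le_sum fun v hv ↦ ?_)
          rw [norm_mul, Complex.norm_intCast]
          gcongr
          apply happ
          rw [mem_aroots]
          exact ⟨hf_ne, by rw [aeval_algebraMap_apply, hf v hv, map_zero]⟩
      _ = _ := by
          rw [← Finset.sum_mul, mul_pow, ← pow_mul, mul_comm f.natDegree]
          ring
  linarith

open Polynomial in
theorem AddMonoidAlgebra.aeval_single_ne_zero {L : Type*} [AddCommGroup L]
    [IsAddTorsionFree L] {z : L} (hz : z ≠ 0) {P : ℤ[X]} (hP : P ≠ 0) :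
    aeval (AddMonoidAlgebra.single z (1 : ℤ)) P ≠ 0 := by
  classical
  intro h
  apply hP
  ext n
  have hinj : Function.Injective fun i : ℕ ↦ i • z :=
    injective_nsmul_iff_not_isOfFinAddOrder.mpr (not_isOfFinAddOrder_of_isAddTorsionFree hz)
  have h' := congrArg (fun x ↦ x.coeff (n • z)) h
  rw [aeval_eq_sum_range] at h'
  simp only [AddMonoidAlgebra.single_pow, one_pow, AddMonoidAlgebra.coeff_sum,
    AddMonoidAlgebra.smul_single, AddMonoidAlgebra.coeff_single, Finsupp.finsetSum_apply,
    Finsupp.single_apply, hinj.eq_iff, AddMonoidAlgebra.coeff_zero,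
    Finsupp.zero_apply, smul_eq_mul, mul_one, Finset.sum_ite_eq', Finset.mem_range] at h'
  split_ifs at h' with hn
  · simpa using h'
  · exact coeff_eq_zero_of_natDegree_lt (by omega)

open Polynomial in
/-- The product of the conjugates `P(e^(σ z))` is formed in the group algebra `ℤ[L]`, then
multiplied by an invariant element making the constant coefficient nonzero. -/
theorem aeval_exp_ne_zero {L : Type*} [Field L] [NumberField L] [IsGalois ℚ L]
    [Algebra L ℂ] {z : L} (hz : z ≠ 0) {P : ℤ[X]} (hP : P ≠ 0) :
    aeval (Complex.exp (algebraMap L ℂ z)) P ≠ 0 := by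
  classical
  intro h
  let φ (σ : L ≃ₐ[ℚ] L) : AddMonoidAlgebra ℤ L →ₐ[ℤ] AddMonoidAlgebra ℤ L :=
    AddMonoidAlgebra.mapDomainAlgHom ℤ ℤ (σ : L →+ L)
  let ev : AddMonoidAlgebra ℤ L →ₐ[ℤ] ℂ := AddMonoidAlgebra.lift ℤ ℂ L
    (Complex.expMonoidHom.comp (AddMonoidHom.toMultiplicative (algebraMap L ℂ).toAddMonoidHom))
  have hφ (σ : L ≃ₐ[ℚ] L) (v : L) (m : ℤ) :
      φ σ (AddMonoidAlgebra.single v m) = AddMonoidAlgebra.single (σ v) m := by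
    simp [φ]
  have hev (v : L) : ev (AddMonoidAlgebra.single v 1) = Complex.exp (algebraMap L ℂ v) := by
    simp [ev]
  let F : AddMonoidAlgebra ℤ L := ∏ σ : L ≃ₐ[ℚ] L, aeval (AddMonoidAlgebra.single (σ z) 1) P
  have hF : F ≠ 0 := Finset.prod_ne_zero_iff.mpr fun σ _ ↦
    AddMonoidAlgebra.aeval_single_ne_zero (by simpa using hz) hP
  have hF_inv (τ : L ≃ₐ[ℚ] L) : φ τ F = F := by
    simp only [F, map_prod, ← aeval_algHom_apply, hφ]
    exact Fintype.prod_equiv (Equiv.mulLeft τ) _ _ fun σ ↦ rfl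
  have hF_ev : ev F = 0 := by
    simp only [F, map_prod, ← aeval_algHom_apply, hev]
    exact Finset.prod_eq_zero (Finset.mem_univ 1) h
  have hcoeff (τ : L ≃ₐ[ℚ] L) {E : AddMonoidAlgebra ℤ L} (hE : φ τ E = E) (v : L) :
      E.coeff (τ v) = E.coeff v := by
    conv_lhs => rw [← hE]
    exact Finsupp.mapDomain_apply τ.injective _ _
  obtain ⟨v₀, hv₀⟩ : ∃ v, F.coeff v ≠ 0 := by
    by_contra! hall
    exact hF (by ext v; simpa using hall v)
  let H : AddMonoidAlgebra ℤ L := ∑ σ : L ≃ₐ[ℚ] L, AddMonoidAlgebra.single (-σ v₀) 1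
  have hH_inv (τ : L ≃ₐ[ℚ] L) : φ τ H = H := by
    simp only [H, map_sum, hφ, map_neg]
    exact Fintype.sum_equiv (Equiv.mulLeft τ) _ _ fun σ ↦ rfl
  refine sum_mul_exp_ne_zero_of_invariant (F * H).coeff ?_
    (fun σ v ↦ hcoeff σ (by rw [map_mul, hF_inv, hH_inv]) v) ?_
  · have (σ : L ≃ₐ[ℚ] L) :
        (F * AddMonoidAlgebra.single (-σ v₀) 1).coeff 0 = F.coeff v₀ := by
      rw [← hcoeff σ (hF_inv σ) v₀]
      simp
    simp only [H, Finset.mul_sum, AddMonoidAlgebra.coeff_sum, Finsupp.finsetSum_apply, this]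
    simpa using hv₀
  · have : ev (F * H) = 0 := by rw [map_mul, hF_ev, zero_mul]
    simpa [ev, AddMonoidAlgebra.lift_apply] using this

/-- **Theorem of Hermite–Lindemann.** For any nonzero complex number `z`, the pair `(z, e^z)`
does not belong to `(Q̄)²`: if `z ≠ 0` is algebraic over `ℚ`, then `e^z` is transcendental
over `ℚ`. -/
theorem hermite_lindemann (z : ℂ) (hz : z ≠ 0) (halg : IsAlgebraic ℚ z) :
    Transcendental ℚ (Complex.exp z) := by
  intro hexp
  obtain ⟨P, hP, hPz⟩ := (IsFractionRing.isAlgebraic_iff ℤ ℚ ℂ).mpr hexp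
  let p := minpoly ℚ z
  let L := IntermediateField.adjoin ℚ (p.rootSet ℂ)
  have hsplit : (p.map (algebraMap ℚ ℂ)).Splits := IsAlgClosed.splits _
  have : p.IsSplittingField ℚ L := IntermediateField.adjoin_rootSet_isSplittingField hsplit
  have : FiniteDimensional ℚ L := Polynomial.IsSplittingField.finiteDimensional L p
  have : NumberField L := {}
  have : IsGalois ℚ L :=
    IsGalois.of_separable_splitting_field (minpoly.irreducible halg.isIntegral).separable
  have hzL : z ∈ L := IntermediateField.subset_adjoin _ _ <|
    (Polynomial.mem_rootSet_of_ne (minpoly.ne_zero halg.isIntegral)).mpr (minpoly.aeval ℚ z)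
  exact aeval_exp_ne_zero (L := L) (z := ⟨z, hzL⟩) (by simpa [Subtype.ext_iff] using hz) hP hPz
end

section
/- Let α be a nonzero algebraic complex number, let log α be a nonzero complex number with exp(log α) = α, and let β be an algebraic complex number which is not rational. Then α^β := exp(β · log α) is transcendental over Q. -/
/-- An entire function vanishing to order at least `r` at `a` is `(z - a) ^ r` times an entire
function. -/
theorem Differentiable.exists_eq_pow_mul {f : ℂ → ℂ} (hf : Differentiable ℂ f) {a : ℂ} {r : ℕ}
    (h : r ≤ analyticOrderAt f a) :
    ∃ g : ℂ → ℂ, Differentiable ℂ g ∧ ∀ z, f z = (z - a) ^ r * g z := by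
  induction r generalizing f with
  | zero => exact ⟨f, hf, by simp⟩
  | succ r ih =>
    have hfa : f a = 0 := by
      refine apply_eq_zero_of_analyticOrderAt_ne_zero fun h0 ↦ ?_
      rw [h0] at h
      simp at h
    have hd : Differentiable ℂ (dslope f a) := by
      rw [← differentiableOn_univ] at hf ⊢
      exact (Complex.differentiableOn_dslope Filter.univ_mem).2 hf
    have hmul : f = (fun z ↦ z - a) * dslope f a := by
      ext z
      simpa using (sub_smul_dslope_of_zero hfa z).symm
    have hord : (r : ℕ∞) ≤ analyticOrderAt (dslope f a) a := by
      rw [hmul, analyticOrderAt_mul (by fun_prop) (hd.analyticAt a)] at h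
      have h1 : analyticOrderAt (fun z : ℂ ↦ z - a) a = 1 := by
        simp
      rw [h1, Nat.cast_add, add_comm, Nat.cast_one] at h
      exact (ENat.add_le_add_iff_left ENat.one_ne_top).1 h
    obtain ⟨g, hg, hfg⟩ := ih hd hord
    refine ⟨g, hg, fun z ↦ ?_⟩
    rw [hmul, Pi.mul_apply, hfg, pow_succ']
    ring

open Finset in
/-- An entire function vanishing to order at least `r` at every point of `s` is divisible by
`∏ a ∈ s, (z - a) ^ r`. -/
theorem Differentiable.exists_eq_prod_pow_mul {f : ℂ → ℂ} (hf : Differentiable ℂ f)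
    (s : Finset ℂ) {r : ℕ} (h : ∀ a ∈ s, r ≤ analyticOrderAt f a) :
    ∃ g : ℂ → ℂ, Differentiable ℂ g ∧ ∀ z, f z = (∏ a ∈ s, (z - a) ^ r) * g z := by
  classical
  induction s using Finset.induction_on generalizing f with
  | empty => exact ⟨f, hf, by simp⟩
  | insert a s ha ih =>
    obtain ⟨g, hg, hfg⟩ := hf.exists_eq_pow_mul (h a (mem_insert_self a s))
    have hord : ∀ b ∈ s, (r : ℕ∞) ≤ analyticOrderAt g b := by
      intro b hb
      have hmul : f = (fun z ↦ (z - a) ^ r) * g := funext hfg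
      have h0 : analyticOrderAt (fun z : ℂ ↦ (z - a) ^ r) b = 0 := by
        rw [analyticOrderAt_eq_zero]
        exact .inr (pow_ne_zero _ (sub_ne_zero.2 fun hab ↦ ha (hab ▸ hb)))
      have := h b (mem_insert_of_mem hb)
      rwa [hmul, analyticOrderAt_mul (by fun_prop) (hg.analyticAt b), h0, zero_add] at this
    obtain ⟨g', hg', hgg'⟩ := ih hg hord
    refine ⟨g', hg', fun z ↦ ?_⟩
    rw [hfg, hgg', prod_insert ha, mul_assoc]

open Finset Nat in
/-- A Schwarz lemma for entire functions vanishing to order at least `r` at `0, …, m - 1`. -/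
theorem Differentiable.norm_iteratedDeriv_le_of_zeros {f : ℂ → ℂ} (hf : Differentiable ℂ f)
    {r m : ℕ} (hz : ∀ l < m, ∀ k < r, iteratedDeriv k f (l : ℂ) = 0) {R M : ℝ}
    (hR : 2 * m ≤ R) (hM : ∀ z, ‖z‖ = R → ‖f z‖ ≤ M) {l : ℕ} (hl : l < m) :
    ‖iteratedDeriv r f (l : ℂ)‖ ≤ r ! * (m : ℝ) ^ (m * r) * (M * (2 / R) ^ (m * r)) := by
  have hm : (1 : ℝ) ≤ m := by exact_mod_cast (by omega : 1 ≤ m)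
  have hR0 : 0 < R := by linarith
  let s : Finset ℂ := (range m).map Nat.castEmbedding
  have hfactor := hf.exists_eq_prod_pow_mul s (r := r) <| by
    simp only [s, Finset.mem_map, Finset.mem_range]
    rintro _ ⟨k, hk, rfl⟩
    exact (natCast_le_analyticOrderAt_iff_iteratedDeriv_eq_zero (hf.analyticAt _)).2 (hz k hk)
  simp only [s, prod_map, Nat.castEmbedding_apply] at hfactor
  obtain ⟨g, hg, hfg⟩ := hfactor
  have hgl : ‖g l‖ ≤ M * (2 / R) ^ (m * r) := by
    refine Complex.norm_le_of_forall_mem_frontier_norm_le (U := Metric.ball 0 R)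
      Metric.isBounded_ball hg.diffContOnCl (fun z hz ↦ ?_) ?_
    · rw [frontier_ball _ hR0.ne', mem_sphere_zero_iff_norm] at hz
      have hprod : (R / 2) ^ (m * r) ≤ ‖∏ k ∈ range m, (z - k) ^ r‖ := by
        rw [norm_prod, pow_mul']
        calc ((R / 2) ^ r) ^ m = ∏ k ∈ range m, (R / 2) ^ r := by simp
          _ ≤ _ := by
            refine prod_le_prod (fun _ _ ↦ by positivity) fun k hk ↦ ?_
            rw [norm_pow]
            gcongr
            have hkm : (k : ℝ) ≤ m := by exact_mod_cast (Finset.mem_range.1 hk).le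
            have := norm_sub_norm_le z (k : ℂ)
            rw [Complex.norm_natCast, hz] at this
            linarith
      have hfz := hM z hz
      rw [hfg, norm_mul] at hfz
      rw [← inv_div, inv_pow, ← div_eq_mul_inv, le_div_iff₀ (by positivity), mul_comm]
      exact (mul_le_mul_of_nonneg_right hprod (norm_nonneg _)).trans hfz
    · apply subset_closure
      have : (l : ℝ) < m := by exact_mod_cast hl
      simp only [mem_ball_zero_iff, Complex.norm_natCast]
      linarith
  let h : ℂ → ℂ := fun z ↦ (∏ k ∈ (range m).erase l, (z - k) ^ r) * g z
  have hh : Differentiable ℂ h := by fun_prop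
  have hfh : ∀ z, f z = (z - l) ^ (r + 0) * h z := fun z ↦ by
    rw [hfg, ← mul_prod_erase _ _ (Finset.mem_range.2 hl), mul_assoc, add_zero]
  obtain ⟨_, -, hder⟩ := iteratedDeriv_mul_pow_sub_of_analytic (fun z ↦ hh.analyticAt z) hfh
  have hprod : ‖∏ k ∈ (range m).erase l, ((l : ℂ) - k) ^ r‖ ≤ (m : ℝ) ^ (m * r) := by
    rw [norm_prod, pow_mul']
    calc _ ≤ ∏ k ∈ (range m).erase l, (m : ℝ) ^ r := by
          refine prod_le_prod (fun _ _ ↦ by positivity) fun k hk ↦ ?_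
          rw [norm_pow]
          gcongr
          have hkm : (k : ℝ) ≤ m := by
            exact_mod_cast (Finset.mem_range.1 (Finset.mem_of_mem_erase hk)).le
          have hlm : (l : ℝ) ≤ m := by exact_mod_cast hl.le
          have : ((l : ℂ) - k) = (((l : ℝ) - k : ℝ) : ℂ) := by push_cast; rfl
          rw [this, Complex.norm_real, Real.norm_eq_abs, abs_le]
          constructor <;> linarith [k.cast_nonneg (α := ℝ), l.cast_nonneg (α := ℝ)]
      _ = ((m : ℝ) ^ r) ^ (m - 1) := by
          rw [prod_const, card_erase_of_mem (Finset.mem_range.2 hl), card_range]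
      _ ≤ _ := pow_le_pow_right₀ (one_le_pow₀ hm) (by omega)
  rw [hder]
  simp only [add_zero, pow_zero, Nat.factorial_zero, sub_self, zero_mul, one_mul, Nat.cast_one,
    div_one, h, norm_mul, Complex.norm_natCast]
  rw [mul_assoc (r ! : ℝ)]
  gcongr

/-- The iterated derivatives of an exponential polynomial with constant coefficients. -/
theorem iteratedDeriv_sum_mul_cexp {ι : Type*} [Fintype ι] (c w : ι → ℂ) (k : ℕ) (z : ℂ) :
    iteratedDeriv k (fun z ↦ ∑ x, c x * Complex.exp (w x * z)) z =
      ∑ x, c x * (w x ^ k * Complex.exp (w x * z)) := by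
  rw [iteratedDeriv_fun_sum fun x _ ↦ by fun_prop]
  refine Finset.sum_congr rfl fun x _ ↦ ?_
  rw [iteratedDeriv_const_mul_field, iteratedDeriv_cexp_const_mul]

/-- Vandermonde: if all the power sums weighted by `c` vanish at distinct nodes, then `c = 0`. -/
theorem eq_zero_of_forall_sum_mul_pow_eq_zero {ι R : Type*} [Fintype ι] [CommRing R] [IsDomain R]
    {c w : ι → R} (hw : Function.Injective w) (h : ∀ k : ℕ, ∑ x, c x * w x ^ k = 0) : c = 0 := by
  let e := Fintype.equivFin ι
  have := Matrix.eq_zero_of_forall_pow_sum_mul_pow_eq_zero (f := w ∘ e.symm) (v := c ∘ e.symm)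
    (hw.comp e.symm.injective) fun i ↦ by
      rw [← h i]
      exact e.symm.sum_comp fun x ↦ c x * w x ^ (i : ℕ)
  ext x
  simpa using congrFun this (e x)

namespace NumberField

variable {K : Type*} [Field K] [NumberField K]

/-- The size inequality: a nonzero algebraic integer with small conjugates cannot be too close
to zero. -/
theorem one_le_norm_mul_house_pow {x : 𝓞 K} (hx : x ≠ 0) (σ : K →+* ℂ) :
    1 ≤ ‖σ x‖ * house (x : K) ^ (Module.finrank ℚ K - 1) := by
  refine le_trans ?_ (norm_norm_le_norm_mul_house_pow (x : K) σ)
  rw [← Algebra.coe_norm_int]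
  have h0 : Algebra.norm ℤ x ≠ 0 := Algebra.norm_ne_zero_iff.2 hx
  have : (1 : ℝ) ≤ |((Algebra.norm ℤ x : ℤ) : ℝ)| := by
    exact_mod_cast Int.one_le_abs h0
  simpa [Int.norm_eq_abs] using this

/-- **Siegel's lemma** over the ring of integers of a number field, for systems with twice as
many unknowns as equations. -/
theorem exists_ne_zero_mulVec_eq_zero_house_le (K : Type*) [Field K] [NumberField K] :
    ∃ C : ℝ, 1 ≤ C ∧ ∀ {α β : Type} [Fintype α] [Fintype β] (A : Matrix α β (𝓞 K)) {B : ℝ},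
      A ≠ 0 → 0 < Fintype.card α → Fintype.card β = 2 * Fintype.card α → 0 ≤ B →
      (∀ k l, house (A k l : K) ≤ B) →
      ∃ ξ : β → 𝓞 K, ξ ≠ 0 ∧ A.mulVec ξ = 0 ∧
        ∀ l, house (ξ l : K) ≤ C * (C * Fintype.card β * B) := by
  classical
  have key : ∃ c : ℝ, ∀ {α β : Type} [Fintype α] [Fintype β] (A : Matrix α β (𝓞 K)) {B : ℝ},
      A ≠ 0 → 0 < Fintype.card α → Fintype.card α < Fintype.card β →
      (∀ k l, house (A k l : K) ≤ B) →
      ∃ ξ : β → 𝓞 K, ξ ≠ 0 ∧ A.mulVec ξ = 0 ∧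
        ∀ l, house (ξ l : K) ≤ c * (c * Fintype.card β * B) ^
          ((Fintype.card α : ℝ) / (Fintype.card β - Fintype.card α)) :=
    ⟨_, fun A _ hA hp hpq hB ↦
      house.exists_ne_zero_int_vec_house_le K A hA hp hpq rfl hB rfl⟩
  obtain ⟨c, hc⟩ := key
  refine ⟨max 1 |c|, le_max_left _ _, fun {α β} _ _ A B hA hp hpq hB0 hB ↦ ?_⟩
  obtain ⟨ξ, hξ0, hξ, hbound⟩ := hc A hA hp (by omega) hB
  refine ⟨ξ, hξ0, hξ, fun l ↦ (hbound l).trans ?_⟩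
  have hp' : (Fintype.card α : ℝ) ≠ 0 := by exact_mod_cast hp.ne'
  have hexp : (Fintype.card α : ℝ) / (Fintype.card β - Fintype.card α) = 1 := by
    rw [hpq]
    push_cast
    field_simp
    ring
  rw [hexp, Real.rpow_one]
  calc c * (c * Fintype.card β * B) = |c| * (|c| * Fintype.card β * B) := by
        linear_combination (-(Fintype.card β * B)) * abs_mul_abs_self c
    _ ≤ _ := by
        gcongr <;> exact le_max_right _ _

end NumberField

/-- The coefficient of the linear system for the auxiliary function: the value, cleared of
denominators, of the `k`-th derivative of `α ^ ((i + j β) z)` at `z = l`, up to `(log α) ^ k`. -/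
def gelfondCoeff {R : Type*} [CommRing R] (D a b c : R) (N k l i j : ℕ) : R :=
  (i * D + j * b) ^ k * (a ^ (i * l) * D ^ (N - i * l)) * (c ^ (j * l) * D ^ (N - j * l))

theorem map_gelfondCoeff {R S : Type*} [CommRing R] [CommRing S] (f : R →+* S) (D a b c : R)
    (N k l i j : ℕ) :
    f (gelfondCoeff D a b c N k l i j) = gelfondCoeff (f D) (f a) (f b) (f c) N k l i j := by
  simp [gelfondCoeff]

theorem gelfondCoeff_mul {R : Type*} [CommRing R] (D a b c : R) {N k l i j : ℕ}
    (hi : i * l ≤ N) (hj : j * l ≤ N) :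
    gelfondCoeff D (D * a) (D * b) (D * c) N k l i j =
      D ^ (k + 2 * N) * ((i + j * b) ^ k * a ^ (i * l) * c ^ (j * l)) := by
  obtain ⟨u, rfl⟩ := Nat.exists_eq_add_of_le hi
  obtain ⟨v, hv⟩ := Nat.exists_eq_add_of_le hj
  have h2 : k + 2 * (i * l + u) = k + (i * l + u) + (j * l + v) := by omega
  have hu : i * l + u - i * l = u := by omega
  have hv' : i * l + u - j * l = v := by omega
  rw [gelfondCoeff, h2, hu, hv', show (i : R) * D + j * (D * b) = D * (i + j * b) by ring]
  simp only [pow_add, mul_pow]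
  ring

namespace NumberField

variable {K : Type*} [Field K] [NumberField K]

theorem house_pow_mul_pow_le {a D : K} {H : ℝ} (ha : house a ≤ H) (hD : house D ≤ H) {p N : ℕ}
    (hp : p ≤ N) : house (a ^ p * D ^ (N - p)) ≤ H ^ N := by
  have ha0 := house_nonneg a
  have hD0 := house_nonneg D
  have hH := ha0.trans ha
  calc house (a ^ p * D ^ (N - p)) ≤ house a ^ p * house D ^ (N - p) :=
        (house_mul_le _ _).trans (mul_le_mul (house_pow_le _ _) (house_pow_le _ _)
          (house_nonneg _) (pow_nonneg (house_nonneg _) _))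
    _ ≤ H ^ p * H ^ (N - p) := by gcongr
    _ = H ^ N := by rw [← pow_add, Nat.add_sub_cancel' hp]

theorem house_gelfondCoeff_le {D a b c : K} {H : ℝ} (hH : 1 ≤ H) (hD : house D ≤ H)
    (ha : house a ≤ H) (hb : house b ≤ H) (hc : house c ≤ H) {m t k l i j r : ℕ} (ht : 1 ≤ t)
    (hm : 1 ≤ m) (hi : i ≤ 2 * m * t) (hj : j ≤ 2 * m * t) (hl : l ≤ m) (hk : k ≤ r)
    (hr : 2 * m * t ^ 2 ≤ r) :
    house (gelfondCoeff D a b c (2 * m * t * m) k l i j) ≤ (4 * m * H ^ (2 * m + 1) * t) ^ r := by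
  have hm' : (1 : ℝ) ≤ m := by exact_mod_cast hm
  have ht' : (1 : ℝ) ≤ t := by exact_mod_cast ht
  have hi' : (i : ℝ) ≤ 2 * m * t := by exact_mod_cast hi
  have hj' : (j : ℝ) ≤ 2 * m * t := by exact_mod_cast hj
  have h1 : house ((i : K) * D + j * b) ≤ 4 * m * t * H := by
    refine (house_add_le _ _).trans ?_
    rw [house_nat_mul, house_nat_mul]
    calc _ ≤ 2 * m * t * H + 2 * m * t * H := by gcongr <;> exact house_nonneg _
      _ = _ := by ring
  have h2 := house_pow_mul_pow_le ha hD (Nat.mul_le_mul hi hl)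
  have h3 := house_pow_mul_pow_le hc hD (Nat.mul_le_mul hj hl)
  have hbase : 1 ≤ 4 * m * t * H := by
    have := one_le_mul_of_one_le_of_one_le (one_le_mul_of_one_le_of_one_le hm' ht') hH
    linarith
  have hN : 2 * m * t * m + 2 * m * t * m ≤ 2 * m * r := by
    have : t ≤ t ^ 2 := Nat.le_self_pow two_ne_zero t
    nlinarith [Nat.mul_le_mul_left (2 * m) (Nat.mul_le_mul_left (2 * m) this),
      Nat.mul_le_mul_left (2 * m) hr]
  calc _ ≤ house ((i : K) * D + j * b) ^ k * H ^ (2 * m * t * m) * H ^ (2 * m * t * m) := by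
        unfold gelfondCoeff
        refine (house_mul_le _ _).trans (mul_le_mul ((house_mul_le _ _).trans (mul_le_mul
          (house_pow_le _ _) h2 (house_nonneg _) ?_)) h3 (house_nonneg _) ?_)
        · exact pow_nonneg (house_nonneg _) _
        · exact mul_nonneg (pow_nonneg (house_nonneg _) _) (by positivity)
    _ ≤ (4 * m * t * H) ^ r * H ^ (2 * m * r) := by
        rw [mul_assoc, ← pow_add]
        refine mul_le_mul ((pow_le_pow_left₀ (house_nonneg _) h1 k).trans
          (pow_le_pow_right₀ hbase hk)) (pow_le_pow_right₀ hH hN) (by positivity) (by positivity)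
    _ = _ := by
        rw [pow_mul, ← mul_pow]
        ring

end NumberField

theorem sq_two_mul_mul_le_pow {m t r : ℕ} (hm : 1 ≤ m) (ht : 1 ≤ t) (hr : 2 * m * t ^ 2 ≤ r) :
    ((2 * m * t : ℕ) : ℝ) ^ 2 ≤ (4 * m : ℝ) ^ r := by
  have hr1 : r ≠ 0 := by
    have : 0 < 2 * m * t ^ 2 := by positivity
    omega
  have h : (2 * m * t) ^ 2 ≤ (4 * m) ^ r :=
    calc (2 * m * t) ^ 2 = 2 * m * (2 * m * t ^ 2) := by ring
      _ ≤ (2 * m) ^ r * 2 ^ r :=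
        Nat.mul_le_mul (Nat.le_self_pow hr1 _) (hr.trans Nat.lt_two_pow_self.le)
      _ = (4 * m) ^ r := by rw [← mul_pow]; ring
  exact_mod_cast h

namespace NumberField

/-- The coefficients of the auxiliary function. -/
theorem exists_gelfond_coefficients {K : Type*} [Field K] [NumberField K] {D a b c : 𝓞 K}
    (hD0 : D ≠ 0) {H : ℝ} (hH : 1 ≤ H) (hD : house (D : K) ≤ H) (ha : house (a : K) ≤ H)
    (hb : house (b : K) ≤ H) (hc : house (c : K) ≤ H) {m : ℕ} (hm : 1 ≤ m) :
    ∃ C : ℝ, 1 ≤ C ∧ ∀ t : ℕ, 1 ≤ t → ∃ ξ : Fin (2 * m * t) × Fin (2 * m * t) → 𝓞 K, ξ ≠ 0 ∧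
      (∀ k < 2 * m * t ^ 2, ∀ l < m,
        ∑ x, gelfondCoeff D a b c (2 * m * t * m) k l x.1 x.2 * ξ x = 0) ∧
      ∀ x, house (ξ x : K) ≤ (C * t) ^ (2 * m * t ^ 2) := by
  obtain ⟨C, hC, hS⟩ := exists_ne_zero_mulVec_eq_zero_house_le K
  have hm' : (1 : ℝ) ≤ m := by exact_mod_cast hm
  refine ⟨C ^ 2 * (4 * m) * (4 * m * H ^ (2 * m + 1)), ?_, fun t ht ↦ ?_⟩
  · have h1 : (1 : ℝ) ≤ 4 * m := by linarith
    exact one_le_mul_of_one_le_of_one_le (one_le_mul_of_one_le_of_one_le (one_le_pow₀ hC) h1)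
      (one_le_mul_of_one_le_of_one_le h1 (one_le_pow₀ hH))
  let n := 2 * m * t ^ 2
  have hn : 0 < n := by positivity
  let A : Matrix (Fin n × Fin m) (Fin (2 * m * t) × Fin (2 * m * t)) (𝓞 K) :=
    fun p x ↦ gelfondCoeff D a b c (2 * m * t * m) p.1 p.2 x.1 x.2
  have hA : A ≠ 0 := fun h0 ↦ by
    have hq : 0 < 2 * m * t := by positivity
    have := congrFun (congrFun h0 (⟨0, hn⟩, ⟨0, hm⟩)) (⟨0, hq⟩, ⟨0, hq⟩)
    simp [A, gelfondCoeff, hD0] at this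
  obtain ⟨ξ, hξ0, hξ, hbound⟩ := hS A (B := (4 * m * H ^ (2 * m + 1) * t) ^ n) hA
    (by simp only [Fintype.card_prod, Fintype.card_fin]; positivity)
    (by simp only [Fintype.card_prod, Fintype.card_fin, n]; ring) (by positivity)
    fun p x ↦ by
      have := house_gelfondCoeff_le hH hD ha hb hc ht hm x.1.2.le x.2.2.le p.2.2.le p.1.2.le
        le_rfl
      simpa only [A, map_gelfondCoeff (algebraMap (𝓞 K) K)] using this
  refine ⟨ξ, hξ0, fun k hk l hl ↦ congrFun hξ (⟨k, hk⟩, ⟨l, hl⟩), fun x ↦ (hbound x).trans ?_⟩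
  have hcard := sq_two_mul_mul_le_pow hm ht (le_refl (2 * m * t ^ 2))
  simp only [Fintype.card_prod, Fintype.card_fin, Nat.cast_mul _ (2 * m * t)]
  rw [← sq]
  have hCn : C ^ 2 ≤ (C ^ 2) ^ n := le_self_pow₀ (one_le_pow₀ hC) hn.ne'
  calc _ = C ^ 2 * ((2 * m * t : ℕ) : ℝ) ^ 2 * (4 * m * H ^ (2 * m + 1) * t) ^ n := by ring
    _ ≤ (C ^ 2) ^ n * (4 * m) ^ n * (4 * m * H ^ (2 * m + 1) * t) ^ n := by gcongr
    _ = _ := by rw [← mul_pow, ← mul_pow]; simp only [n]; ring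

end NumberField

/-- The exponents `i + j β` of the auxiliary function are distinct for irrational `β`. -/
theorem injective_natCast_add_natCast_mul {K : Type*} [Field K] [CharZero K] {b : K}
    (hb : ∀ q : ℚ, (q : K) ≠ b) (N : ℕ) :
    Function.Injective fun x : Fin N × Fin N ↦ ((x.1 : ℕ) : K) + (x.2 : ℕ) * b := by
  rintro ⟨i, j⟩ ⟨i', j'⟩ h
  simp only at h
  have hj : (j : ℕ) = j' := by
    by_contra hne
    have hne' : ((j : ℕ) : K) - (j' : ℕ) ≠ 0 := sub_ne_zero.2 (by exact_mod_cast hne)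
    refine hb (((i' : ℕ) - (i : ℕ) : ℚ) / ((j : ℕ) - (j' : ℕ))) ?_
    push_cast
    rw [div_eq_iff hne']
    linear_combination -h
  rw [hj, add_left_inj] at h
  have hi : (i : ℕ) = i' := by exact_mod_cast h
  rw [Prod.mk.injEq]
  exact ⟨Fin.ext hi, Fin.ext hj⟩

open Nat in
/-- The comparison of the analytic upper bound `u` with the arithmetic lower bound `u⁻¹ ≤ v`
bounds the parameter `t`. -/
theorem natCast_le_of_one_le_mul {A B C : ℝ} (hA : 0 ≤ A) (hB : 0 ≤ B) (hC : 0 ≤ C)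
    {h m t r : ℕ} (hh : 1 ≤ h) (hm : m = 2 * h + 2) (ht : 1 ≤ t) (hr : t ^ 2 ≤ r) {u v : ℝ}
    (hu : u ≤ A ^ r * (r ! * (m : ℝ) ^ (m * r) * ((B * t) ^ r * (2 / (r / t)) ^ (m * r))))
    (hv0 : 0 ≤ v) (hv : v ≤ (C * t ^ 2) ^ r) (huv : 1 ≤ u * v ^ (h - 1)) :
    (t : ℝ) ≤ A * (m : ℝ) ^ m * B * 2 ^ m * C ^ (h - 1) := by
  obtain ⟨d, rfl⟩ := Nat.exists_eq_add_of_le' hh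
  rw [Nat.add_sub_cancel] at huv ⊢
  have ht0 : (0 : ℝ) < t := by exact_mod_cast ht
  have hr' : (t : ℝ) ^ 2 ≤ r := by exact_mod_cast hr
  have hr0 : (0 : ℝ) < r := lt_of_lt_of_le (by positivity) hr'
  set Y : ℝ := A * (r * (m : ℝ) ^ m * (B * t * (2 / (r / t)) ^ m)) * (C * t ^ 2) ^ d with hY
  have hY0 : 0 ≤ Y := by positivity
  have hfac : (r ! : ℝ) ≤ (r : ℝ) ^ r := by exact_mod_cast Nat.factorial_le_pow r
  have hYr : 1 ≤ Y ^ r :=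
    calc 1 ≤ u * v ^ d := huv
      _ ≤ A ^ r * ((r : ℝ) ^ r * (m : ℝ) ^ (m * r) * ((B * t) ^ r * (2 / (r / t)) ^ (m * r))) *
          ((C * t ^ 2) ^ r) ^ d := by
        refine mul_le_mul (hu.trans (by gcongr)) (by gcongr) (by positivity) (by positivity)
      _ = Y ^ r := by
        rw [hY]
        simp only [mul_pow, ← pow_mul, mul_comm r]
        ring
  have hY1 : 1 ≤ Y := by
    by_contra! hlt
    have := pow_lt_one₀ hY0 hlt (by exact_mod_cast hr0.ne' : r ≠ 0)
    linarith
  have hYt : Y * t = A * (m : ℝ) ^ m * B * 2 ^ m * C ^ d * ((t : ℝ) ^ 2 / r) ^ (m - 1) := by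
    obtain rfl : m = 2 * d + 3 + 1 := by omega
    rw [hY, Nat.add_sub_cancel, div_div_eq_mul_div]
    simp only [div_pow, mul_pow]
    field_simp
    ring
  calc (t : ℝ) ≤ Y * t := le_mul_of_one_le_left ht0.le hY1
    _ = _ := hYt
    _ ≤ _ := by
      refine mul_le_of_le_one_right (by positivity) (pow_le_one₀ (by positivity) ?_)
      rwa [div_le_one hr0]

namespace NumberField

/-- The **Gelfond–Schneider theorem**, phrased inside a number field `K` embedded in `ℂ`. -/
theorem gelfond_schneider_aux {K : Type*} [Field K] [NumberField K] (σ : K →+* ℂ) {a b c : K}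
    {lam : ℂ} (hlam : lam ≠ 0) (ha : Complex.exp lam = σ a) (hc : Complex.exp (σ b * lam) = σ c)
    (hb : ∀ q : ℚ, (q : K) ≠ b) : False := by
  classical
  obtain ⟨y, hy0, hy⟩ := exists_integral_multiples ℤ ℚ ({a, b, c} : Finset K)
  simp only [zsmul_eq_mul] at hy
  let D : 𝓞 K := (y : 𝓞 K)
  let a' : 𝓞 K := ⟨y * a, hy a (by simp)⟩
  let b' : 𝓞 K := ⟨y * b, hy b (by simp)⟩
  let c' : 𝓞 K := ⟨y * c, hy c (by simp)⟩
  have hD0 : D ≠ 0 := Int.cast_ne_zero.2 hy0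
  obtain ⟨H, hH, hDH, haH, hbH, hcH⟩ : ∃ H : ℝ, 1 ≤ H ∧ house (D : K) ≤ H ∧ house (a' : K) ≤ H ∧
      house (b' : K) ≤ H ∧ house (c' : K) ≤ H := by
    refine ⟨1 + house (D : K) + house (a' : K) + house (b' : K) + house (c' : K), ?_⟩
    have h1 := house_nonneg (D : K)
    have h2 := house_nonneg (a' : K)
    have h3 := house_nonneg (b' : K)
    have h4 := house_nonneg (c' : K)
    refine ⟨?_, ?_, ?_, ?_, ?_⟩ <;> linarith
  let τ : 𝓞 K →+* ℂ := σ.comp (algebraMap (𝓞 K) K)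
  have hτ (x : 𝓞 K) : ‖τ x‖ ≤ house (x : K) := norm_embedding_le_house _ σ
  have hτ0 (x : 𝓞 K) : τ x = 0 ↔ x = 0 := by simp [τ]
  have hτD : τ D = y := map_intCast τ y
  have hτa : τ a' = y * σ a := by
    change σ (y * a) = _
    simp
  have hτb : τ b' = y * σ b := by
    change σ (y * b) = _
    simp
  have hτc : τ c' = y * σ c := by
    change σ (y * c) = _
    simp
  have hyC : (y : ℂ) ≠ 0 := Int.cast_ne_zero.2 hy0
  have hyH : ‖(y : ℂ)‖ ≤ H := by
    rw [← hτD]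
    exact (hτ D).trans hDH
  obtain ⟨h, hh⟩ : ∃ h, h = Module.finrank ℚ K := ⟨_, rfl⟩
  have hh1 : 1 ≤ h := hh ▸ Module.finrank_pos
  obtain ⟨m, hm⟩ : ∃ m, m = 2 * h + 2 := ⟨_, rfl⟩
  have hm1 : 1 ≤ m := by omega
  have hm' : (1 : ℝ) ≤ m := by exact_mod_cast hm1
  obtain ⟨C, hC, hξ⟩ := exists_gelfond_coefficients hD0 hH hDH haH hbH hcH hm1
  set E : ℝ := Real.exp (2 * m * ((1 + ‖σ b‖) * ‖lam‖)) with hE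
  obtain ⟨t, ht⟩ := exists_nat_gt (max 1 (H ^ (2 * m + 1) * ‖lam‖⁻¹ * (m : ℝ) ^ m *
    (4 * m * C * E) * 2 ^ m * (4 * m * (4 * m * H ^ (2 * m + 1)) * C) ^ (h - 1)))
  have ht1 : 1 ≤ t := by exact_mod_cast ((le_max_left _ _).trans_lt ht).le
  have ht' : (1 : ℝ) ≤ t := by exact_mod_cast ht1
  obtain ⟨ξ, hξ0, hvan, hξH⟩ := hξ t ht1
  let w : Fin (2 * m * t) × Fin (2 * m * t) → ℂ := fun x ↦ ((x.1 : ℕ) + (x.2 : ℕ) * σ b) * lam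
  let F : ℂ → ℂ := fun z ↦ ∑ x, τ (ξ x) * Complex.exp (w x * z)
  have hF : Differentiable ℂ F := by fun_prop
  have hFder (k : ℕ) (z : ℂ) : iteratedDeriv k F z =
      ∑ x, τ (ξ x) * (w x ^ k * Complex.exp (w x * z)) :=
    iteratedDeriv_sum_mul_cexp _ _ _ _
  let X : ℕ → ℕ → 𝓞 K := fun k l ↦
    ∑ x, gelfondCoeff D a' b' c' (2 * m * t * m) k l x.1 x.2 * ξ x
  have hX (k l : ℕ) (hl : l < m) : lam ^ k * τ (X k l) =
      (y : ℂ) ^ (k + 2 * (2 * m * t * m)) * iteratedDeriv k F l := by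
    simp only [X, hFder, map_sum, map_mul, Finset.mul_sum]
    refine Finset.sum_congr rfl fun x _ ↦ ?_
    have hcoef : τ (gelfondCoeff D a' b' c' (2 * m * t * m) k l x.1 x.2) =
        (y : ℂ) ^ (k + 2 * (2 * m * t * m)) * (((x.1 : ℕ) + (x.2 : ℕ) * σ b) ^ k *
          σ a ^ ((x.1 : ℕ) * l) * σ c ^ ((x.2 : ℕ) * l)) := by
      rw [map_gelfondCoeff, hτD, hτa, hτb, hτc,
        gelfondCoeff_mul _ _ _ _ (Nat.mul_le_mul x.1.2.le hl.le) (Nat.mul_le_mul x.2.2.le hl.le)]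
    have hexp : Complex.exp (w x * l) = σ a ^ ((x.1 : ℕ) * l) * σ c ^ ((x.2 : ℕ) * l) := by
      rw [← ha, ← hc, ← Complex.exp_nat_mul, ← Complex.exp_nat_mul, ← Complex.exp_add]
      congr 1
      push_cast
      ring
    rw [hcoef, hexp]
    simp only [w, mul_pow]
    ring
  have hX0 (k l : ℕ) (hl : l < m) : X k l = 0 ↔ iteratedDeriv k F l = 0 := by
    have h1 : X k l = 0 ↔ lam ^ k * τ (X k l) = 0 := by
      simp [hlam, hτ0]
    rw [h1, hX k l hl]
    simp [hyC]
  have hex : ∃ k, ∃ l < m, iteratedDeriv k F (l : ℂ) ≠ 0 := by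
    by_contra! hzero
    have hinj : Function.Injective w := by
      intro x x' hxx'
      refine injective_natCast_add_natCast_mul hb _ (σ.injective ?_)
      simpa using mul_right_cancel₀ hlam hxx'
    have := eq_zero_of_forall_sum_mul_pow_eq_zero (c := fun x ↦ τ (ξ x)) hinj fun k ↦ by
      simpa [hFder] using hzero k 0 hm1
    refine hξ0 (funext fun x ↦ ?_)
    exact (hτ0 _).1 (congrFun this x)
  obtain ⟨r, ⟨l, hl, hrl⟩, hrmin⟩ : ∃ r, (∃ l < m, iteratedDeriv r F (l : ℂ) ≠ 0) ∧
      ∀ k < r, ∀ l < m, iteratedDeriv k F (l : ℂ) = 0 := by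
    refine ⟨Nat.find hex, Nat.find_spec hex, fun k hk l hl ↦ ?_⟩
    have := Nat.find_min hex hk
    push Not at this
    exact this l hl
  have hnr : 2 * m * t ^ 2 ≤ r := by
    by_contra! hlt
    exact hrl ((hX0 r l hl).1 (hvan r hlt l hl))
  have hnr' : 2 * (m : ℝ) * t ^ 2 ≤ r := by exact_mod_cast hnr
  have hq := sq_two_mul_mul_le_pow hm1 ht1 hnr
  have hCt : 1 ≤ C * t := one_le_mul_of_one_le_of_one_le hC ht'
  have hξr (x) : house (ξ x : K) ≤ (C * t) ^ r :=
    (hξH x).trans (pow_le_pow_right₀ hCt hnr)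
  have hXhouse : house (X r l : K) ≤ (4 * m * (4 * m * H ^ (2 * m + 1)) * C * t ^ 2) ^ r := by
    calc house (X r l : K) ≤ ∑ _x : Fin (2 * m * t) × Fin (2 * m * t),
          (4 * m * H ^ (2 * m + 1) * t) ^ r * (C * t) ^ r := by
          simp only [X, map_sum, map_mul]
          refine (house_sum_le_sum_house _ _).trans (Finset.sum_le_sum fun x _ ↦ ?_)
          refine (house_mul_le _ _).trans (mul_le_mul ?_ (hξr x) (house_nonneg _) (by positivity))
          rw [map_gelfondCoeff (algebraMap (𝓞 K) K)]
          exact house_gelfondCoeff_le hH hDH haH hbH hcH ht1 hm1 x.1.2.le x.2.2.le hl.le le_rfl hnr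
      _ = ((2 * m * t : ℕ) : ℝ) ^ 2 * ((4 * m * H ^ (2 * m + 1) * t) ^ r * (C * t) ^ r) := by
          simp [sq]
      _ ≤ (4 * m) ^ r * ((4 * m * H ^ (2 * m + 1) * t) ^ r * (C * t) ^ r) := by gcongr
      _ = _ := by
          rw [← mul_pow, ← mul_pow]
          ring
  have hFbound (z : ℂ) (hz : ‖z‖ = r / t) : ‖F z‖ ≤ (4 * m * C * E * t) ^ r := by
    calc ‖F z‖ ≤ ∑ _x : Fin (2 * m * t) × Fin (2 * m * t), (C * t) ^ r * E ^ r := by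
          refine (norm_sum_le _ _).trans (Finset.sum_le_sum fun x _ ↦ ?_)
          rw [norm_mul]
          refine mul_le_mul ((hτ _).trans (hξr x)) ?_ (norm_nonneg _)
            (by positivity)
          have hx1 : ((x.1 : ℕ) : ℝ) ≤ 2 * m * t := by exact_mod_cast x.1.2.le
          have hx2 : ((x.2 : ℕ) : ℝ) ≤ 2 * m * t := by exact_mod_cast x.2.2.le
          have hw : ‖w x‖ ≤ 2 * m * t * ((1 + ‖σ b‖) * ‖lam‖) := by
            rw [norm_mul, ← mul_assoc]
            gcongr
            refine (norm_add_le _ _).trans ?_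
            rw [norm_mul, Complex.norm_natCast, Complex.norm_natCast, mul_add, mul_one]
            gcongr
          rw [hE, ← Real.exp_nat_mul]
          refine (Complex.norm_exp_le_exp_norm _).trans (Real.exp_le_exp.2 ?_)
          rw [norm_mul, hz]
          calc _ ≤ 2 * m * t * ((1 + ‖σ b‖) * ‖lam‖) * (r / t) := by gcongr
            _ = _ := by field_simp
      _ = ((2 * m * t : ℕ) : ℝ) ^ 2 * ((C * t) ^ r * E ^ r) := by simp [sq]
      _ ≤ (4 * m) ^ r * ((C * t) ^ r * E ^ r) := by gcongr
      _ = _ := by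
          rw [← mul_pow, ← mul_pow]
          ring
  have hR : 2 * (m : ℝ) ≤ r / t := by
    rw [le_div_iff₀ (by positivity)]
    nlinarith [mul_le_mul_of_nonneg_left (le_self_pow₀ ht' two_ne_zero)
      (by linarith : 0 ≤ 2 * (m : ℝ))]
  have hder := hF.norm_iteratedDeriv_le_of_zeros (fun l hl k hk ↦ hrmin k hk l hl) hR hFbound hl
  have hτX : ‖τ (X r l)‖ ≤ (H ^ (2 * m + 1) * ‖lam‖⁻¹) ^ r * ‖iteratedDeriv r F (l : ℂ)‖ := by
    have hlam' : 0 < ‖lam‖ := norm_pos_iff.2 hlam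
    have hpow : r + 2 * (2 * m * t * m) ≤ (2 * m + 1) * r := by
      have : t ≤ t ^ 2 := Nat.le_self_pow two_ne_zero t
      nlinarith [Nat.mul_le_mul_left (2 * m) (Nat.mul_le_mul_left (2 * m) this),
        Nat.mul_le_mul_left (2 * m) hnr]
    have heq := congrArg norm (hX r l hl)
    rw [norm_mul, norm_mul, norm_pow, norm_pow] at heq
    have hyr : ‖(y : ℂ)‖ ^ (r + 2 * (2 * m * t * m)) ≤ (H ^ (2 * m + 1)) ^ r := by
      rw [← pow_mul]
      exact (pow_le_pow_left₀ (norm_nonneg _) hyH _).trans (pow_le_pow_right₀ hH hpow)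
    rw [mul_pow, inv_pow, mul_right_comm, ← div_eq_mul_inv, le_div_iff₀ (by positivity), mul_comm,
      heq]
    gcongr
  have hnorm : 1 ≤ ‖τ (X r l)‖ * house (X r l : K) ^ (Module.finrank ℚ K - 1) :=
    one_le_norm_mul_house_pow (mt (hX0 r l hl).1 hrl) σ
  rw [← hh] at hnorm
  have htr : t ^ 2 ≤ r := le_trans (Nat.le_mul_of_pos_left _ (by positivity)) hnr
  have hfinal := natCast_le_of_one_le_mul (by positivity) (by positivity) (by positivity) hh1 hm
    ht1 htr (hτX.trans (mul_le_mul_of_nonneg_left hder (by positivity))) (house_nonneg _) hXhouse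
    hnorm
  exact absurd hfinal (not_le.2 ((le_max_right _ _).trans_lt ht))

end NumberField

/-- **Theorem of Gelfond–Schneider.** Let `α` be a nonzero algebraic complex number, let
`logα` be a nonzero complex number with `exp logα = α`, and let `β` be an algebraic complex
number which is not rational.  Then `α ^ β := exp (β * logα)` is transcendental over `ℚ`. -/
theorem gelfond_schneider (α logα β : ℂ) (hα : α ≠ 0) (hαalg : IsAlgebraic ℚ α)
    (hlog : logα ≠ 0) (hexp : Complex.exp logα = α)
    (hβalg : IsAlgebraic ℚ β) (hβirr : ∀ q : ℚ, (q : ℂ) ≠ β) :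
    Transcendental ℚ (Complex.exp (β * logα)) := by
  intro hγalg
  let K := IntermediateField.adjoin ℚ ({α, β, Complex.exp (β * logα)} : Set ℂ)
  have hmem {x : ℂ} (hx : x ∈ ({α, β, Complex.exp (β * logα)} : Set ℂ)) : x ∈ K :=
    IntermediateField.subset_adjoin ℚ _ hx
  have : FiniteDimensional ℚ K := by
    refine IntermediateField.finiteDimensional_adjoin fun x hx ↦ ?_
    rcases hx with rfl | rfl | rfl
    exacts [hαalg.isIntegral, hβalg.isIntegral, hγalg.isIntegral]
  have : NumberField K := { }
  exact NumberField.gelfond_schneider_aux (algebraMap K ℂ) (a := ⟨α, hmem (by simp)⟩)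
    (b := ⟨β, hmem (by simp)⟩) (c := ⟨_, hmem (by simp)⟩) hlog hexp rfl
    fun q hq ↦ hβirr q (by simpa using congrArg (algebraMap K ℂ) hq)
end
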